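/- Determinacy of the big-step duration semantics: for every closed HybCore computation term p, at most one big-step duration judgement of the form p ⇓ d or p ⇓ d, v is derivable; in particular p cannot both diverge with some duration and terminate with some duration and value, and in each case the duration d (and the value v) are uniquely determined by p. -/

import Mathlib

set_option autoImplicit false

open scoped NNReal ENNReal

/-! ### HybCore types and signatures -/

inductive Ty : Type where
  | nat : Ty
  | real : Ty
  | unit : Ty
  | bool : Ty
  | prod : Ty → Ty → Ty

/-- Denotation of types. -/
def Ty.den : Ty → Type
  | .nat => ℕ
  | .real => ℝ
  | .unit => Unit
  | .bool => Bool
  | .prod A B => A.den × B.den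

inductive BaseTy : Type where
  | nat : BaseTy
  | real : BaseTy
  | bool : BaseTy

def BaseTy.toTy : BaseTy → Ty
  | .nat => .nat
  | .real => .real
  | .bool => .bool

/-- A signature of typed operation symbols `f : A → B` with `B ∈ {ℕ, ℝ, 2}`,
together with their interpretation as functions between the denoted sets. -/
structure Signature : Type 1 where
  Op : Type
  dom : Op → Ty
  cod : Op → BaseTy
  interp : (f : Op) → (dom f).den → ((cod f).toTy).den

/-! ### Terms -/

abbrev Ctx := List Ty

inductive Var : Ctx → Ty → Type where
  | here {Γ : Ctx} {A : Ty} : Var (A :: Γ) A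
  | there {Γ : Ctx} {A B : Ty} : Var Γ A → Var (B :: Γ) A

/-- Value terms in context (a constant is included for each real number, so
that time instants can be substituted for variables of type `ℝ`). -/
inductive Val (σ : Signature) : Ctx → Ty → Type where
  | var {Γ : Ctx} {A : Ty} : Var Γ A → Val σ Γ A
  | star {Γ : Ctx} : Val σ Γ .unit
  | tt {Γ : Ctx} : Val σ Γ .bool
  | ff {Γ : Ctx} : Val σ Γ .bool
  | realC {Γ : Ctx} : ℝ → Val σ Γ .real
  | pair {Γ : Ctx} {A B : Ty} : Val σ Γ A → Val σ Γ B → Val σ Γ (.prod A B)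
  | app {Γ : Ctx} (f : σ.Op) : Val σ Γ (σ.dom f) → Val σ Γ ((σ.cod f).toTy)

/-- Computation terms in context: `now v`, pattern matching, if-then-else,
sequencing, while-loops and trajectory abstraction. -/
inductive Comp (σ : Signature) : Ctx → Ty → Type where
  | now {Γ : Ctx} {A : Ty} : Val σ Γ A → Comp σ Γ A
  | pm {Γ : Ctx} {A B C : Ty} :
      Val σ Γ (.prod A B) → Comp σ (A :: B :: Γ) C → Comp σ Γ C
  | cond {Γ : Ctx} {A : Ty} : Val σ Γ .bool → Comp σ Γ A → Comp σ Γ A → Comp σ Γ A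
  | seq {Γ : Ctx} {A B : Ty} : Comp σ Γ A → Comp σ (A :: Γ) B → Comp σ Γ B
  | wh {Γ : Ctx} {A : Ty} :
      Comp σ Γ A → Val σ (A :: Γ) .bool → Comp σ (A :: Γ) A → Comp σ Γ A
  | traj {Γ : Ctx} {A : Ty} :
      Val σ (.real :: Γ) A → Val σ (A :: Γ) .bool → Comp σ Γ A

/-! ### Substitution of closed values -/

def Var.remove : {Γ : Ctx} → {A : Ty} → Var Γ A → Ctx
  | _ :: Γ, _, .here => Γ
  | B :: _, _, .there x => B :: Var.remove x

def weakenVal {σ : Signature} {Γ : Ctx} : {A : Ty} → Val σ [] A → Val σ Γ A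
  | _, .var x => nomatch x
  | _, .star => .star
  | _, .tt => .tt
  | _, .ff => .ff
  | _, .realC r => .realC r
  | _, .pair a b => .pair (weakenVal a) (weakenVal b)
  | _, .app f a => .app f (weakenVal a)

def Var.compare : {Γ : Ctx} → {A B : Ty} → (x : Var Γ A) → (y : Var Γ B) →
    PSum (B = A) (Var x.remove B)
  | _, _, _, .here, .here => .inl rfl
  | _, _, _, .here, .there y' => .inr y'
  | _, _, _, .there _, .here => .inr .here
  | _, _, _, .there x', .there y' =>
      match Var.compare x' y' with
      | .inl h => .inl h
      | .inr z => .inr (.there z)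

/-- Substitution of a closed value for a variable in a value term. -/
def substVal {σ : Signature} {A : Ty} (v : Val σ [] A) :
    {Γ : Ctx} → {B : Ty} → Val σ Γ B → (x : Var Γ A) → Val σ x.remove B
  | _, _, .var y, x =>
      match Var.compare x y with
      | .inl rfl => weakenVal v
      | .inr z => .var z
  | _, _, .star, _ => .star
  | _, _, .tt, _ => .tt
  | _, _, .ff, _ => .ff
  | _, _, .realC r, _ => .realC r
  | _, _, .pair a b, x => .pair (substVal v a x) (substVal v b x)
  | _, _, .app f a, x => .app f (substVal v a x)

/-- Substitution of a closed value for a variable in a computation term. -/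
def substComp {σ : Signature} {A : Ty} (v : Val σ [] A) :
    {Γ : Ctx} → {B : Ty} → Comp σ Γ B → (x : Var Γ A) → Comp σ x.remove B
  | _, _, .now w, x => .now (substVal v w x)
  | _, _, .pm w k, x => .pm (substVal v w x) (substComp v k (.there (.there x)))
  | _, _, .cond b p q, x => .cond (substVal v b x) (substComp v p x) (substComp v q x)
  | _, _, .seq p q, x => .seq (substComp v p x) (substComp v q (.there x))
  | _, _, .wh p b q, x =>
      .wh (substComp v p x) (substVal v b (.there x)) (substComp v q (.there x))
  | _, _, .traj h b, x => .traj (substVal v h (.there x)) (substVal v b (.there x))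

/-- `q[v/x]` for the head variable. -/
def Comp.inst {σ : Signature} {Γ : Ctx} {A B : Ty}
    (q : Comp σ (A :: Γ) B) (v : Val σ [] A) : Comp σ Γ B :=
  substComp v q .here

def Val.inst {σ : Signature} {Γ : Ctx} {A B : Ty}
    (w : Val σ (A :: Γ) B) (v : Val σ [] A) : Val σ Γ B :=
  substVal v w .here

/-- `p[v/x, w/y]` for pattern matching. -/
def Comp.inst2 {σ : Signature} {Γ : Ctx} {A B C : Ty}
    (k : Comp σ (A :: B :: Γ) C) (va : Val σ [] A) (vb : Val σ [] B) : Comp σ Γ C :=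
  (k.inst va).inst vb

/-! ### Denotation of values -/

def Env : Ctx → Type
  | [] => Unit
  | A :: Γ => A.den × Env Γ

def Var.lookup : {Γ : Ctx} → {A : Ty} → Var Γ A → Env Γ → A.den
  | _, _, .here, ρ => ρ.1
  | _, _, .there x, ρ => Var.lookup x ρ.2

def Val.den {σ : Signature} : {Γ : Ctx} → {A : Ty} → Val σ Γ A → Env Γ → A.den
  | _, _, .var x, ρ => x.lookup ρ
  | _, _, .star, _ => ()
  | _, _, .tt, _ => true
  | _, _, .ff, _ => false
  | _, _, .realC r, _ => r
  | _, _, .pair a b, ρ => (a.den ρ, b.den ρ)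
  | _, _, .app f a, ρ => σ.interp f (a.den ρ)

/-! ### Trajectory abstraction: duration and guard -/

/-- The (boolean denotation of the) guard `w[v[s/t]/x]` of a trajectory
abstraction `(x := t.v) & w` at time instant `s`. -/
def trajGuard {σ : Signature} {A : Ty}
    (h : Val σ [Ty.real] A) (b : Val σ [A] Ty.bool) (s : ℝ) : Bool :=
  (b.inst (h.inst (.realC s))).den ()

/-- The duration `sup {e ∣ ∀ s ∈ [0,e], w[v[s/t]/x] = true}` of a trajectory
abstraction `(x := t.v) & w`. -/
noncomputable def trajDur {σ : Signature} {A : Ty}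
    (h : Val σ [Ty.real] A) (b : Val σ [A] Ty.bool) : ℝ≥0∞ :=
  sSup {e : ℝ≥0∞ | ∀ s : ℝ≥0, (s : ℝ≥0∞) ≤ e → trajGuard h b (s : ℝ) = true}

/-- A trajectory abstraction terminates iff its duration `d` is finite and the
guard holds at `d`. -/
noncomputable def trajStops {σ : Signature} {A : Ty}
    (h : Val σ [Ty.real] A) (b : Val σ [A] Ty.bool) : Prop :=
  ∃ d : ℝ≥0, trajDur h b = (d : ℝ≥0∞) ∧ trajGuard h b (d : ℝ) = true

/-! ### Big-step duration semantics (Figure 3) -/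

mutual
  /-- `p ⇓ d` : divergence in time `d ∈ [0,∞]`. -/
  inductive BigDiv {σ : Signature} : {A : Ty} → Comp σ [] A → ℝ≥0∞ → Prop where
    | pm {A B C : Ty} {v : Val σ [] A} {w : Val σ [] B} {k : Comp σ [A, B] C} {d : ℝ≥0∞} :
        BigDiv (k.inst2 v w) d → BigDiv (.pm (.pair v w) k) d
    | condT {A : Ty} {v : Val σ [] .bool} {p q : Comp σ [] A} {d : ℝ≥0∞} :
        v.den () = true → BigDiv p d → BigDiv (.cond v p q) d
    | condF {A : Ty} {v : Val σ [] .bool} {p q : Comp σ [] A} {d : ℝ≥0∞} :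
        v.den () = false → BigDiv q d → BigDiv (.cond v p q) d
    | seq1 {A B : Ty} {p : Comp σ [] A} {q : Comp σ [A] B} {d : ℝ≥0∞} :
        BigDiv p d → BigDiv (p.seq q) d
    | seq2 {A B : Ty} {p : Comp σ [] A} {q : Comp σ [A] B}
        {d : ℝ≥0} {v : Val σ [] A} {e : ℝ≥0∞} :
        BigConv p d v → BigDiv (q.inst v) e → BigDiv (p.seq q) ((d : ℝ≥0∞) + e)
    | traj {A : Ty} {h : Val σ [Ty.real] A} {b : Val σ [A] Ty.bool} :
        ¬ trajStops h b → BigDiv (.traj h b) (trajDur h b)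
    | wh1 {A : Ty} {p : Comp σ [] A} {b : Val σ [A] Ty.bool} {q : Comp σ [A] A} {d : ℝ≥0∞} :
        BigDiv p d → BigDiv (.wh p b q) d
    | wh3 {A : Ty} {p : Comp σ [] A} {b : Val σ [A] Ty.bool} {q : Comp σ [A] A}
        {d : ℝ≥0} {w : Val σ [] A} {r : ℝ≥0∞} :
        BigConv p d w → (b.inst w).den () = true →
        BigDiv (Comp.wh (q.inst w) b q) r → BigDiv (.wh p b q) ((d : ℝ≥0∞) + r)
    | wh5 {A : Ty} {p : Comp σ [] A} {b : Val σ [A] Ty.bool} {q : Comp σ [A] A}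
        (ws : ℕ → Val σ [] A) (ds : ℕ → ℝ≥0) :
        BigConv p (ds 0) (ws 0) →
        (∀ i : ℕ, (b.inst (ws i)).den () = true) →
        (∀ i : ℕ, BigConv (q.inst (ws i)) (ds (i + 1)) (ws (i + 1))) →
        BigDiv (.wh p b q) (∑' i : ℕ, (ds i : ℝ≥0∞))

  /-- `p ⇓ d, v` : termination with closed value `v` in time `d ∈ [0,∞)`. -/
  inductive BigConv {σ : Signature} : {A : Ty} → Comp σ [] A → ℝ≥0 → Val σ [] A → Prop where
    | now {A : Ty} {v : Val σ [] A} : BigConv (.now v) 0 v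
    | pm {A B C : Ty} {v : Val σ [] A} {w : Val σ [] B} {k : Comp σ [A, B] C}
        {d : ℝ≥0} {u : Val σ [] C} :
        BigConv (k.inst2 v w) d u → BigConv (.pm (.pair v w) k) d u
    | condT {A : Ty} {v : Val σ [] .bool} {p q : Comp σ [] A} {d : ℝ≥0} {u : Val σ [] A} :
        v.den () = true → BigConv p d u → BigConv (.cond v p q) d u
    | condF {A : Ty} {v : Val σ [] .bool} {p q : Comp σ [] A} {d : ℝ≥0} {u : Val σ [] A} :
        v.den () = false → BigConv q d u → BigConv (.cond v p q) d u
    | seq {A B : Ty} {p : Comp σ [] A} {q : Comp σ [A] B}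
        {d e : ℝ≥0} {v : Val σ [] A} {w : Val σ [] B} :
        BigConv p d v → BigConv (q.inst v) e w → BigConv (p.seq q) (d + e) w
    | traj {A : Ty} {h : Val σ [Ty.real] A} {b : Val σ [A] Ty.bool} {d : ℝ≥0} :
        trajDur h b = (d : ℝ≥0∞) → trajGuard h b (d : ℝ) = true →
        BigConv (.traj h b) d (h.inst (.realC (d : ℝ)))
    | wh2 {A : Ty} {p : Comp σ [] A} {b : Val σ [A] Ty.bool} {q : Comp σ [A] A}
        {d : ℝ≥0} {w : Val σ [] A} :
        BigConv p d w → (b.inst w).den () = false → BigConv (.wh p b q) d w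
    | wh4 {A : Ty} {p : Comp σ [] A} {b : Val σ [A] Ty.bool} {q : Comp σ [A] A}
        {d r : ℝ≥0} {w u : Val σ [] A} :
        BigConv p d w → (b.inst w).den () = true →
        BigConv (Comp.wh (q.inst w) b q) r u → BigConv (.wh p b q) (d + r) u
end

/-- All derivable judgements for `p` agree with `p ⇓ d, v`. -/
def DetConv {σ : Signature} {A : Ty} (p : Comp σ [] A) (d : ℝ≥0) (v : Val σ [] A) : Prop :=
  (∀ d' v', BigConv p d' v' → d = d' ∧ v = v') ∧ (∀ d', BigDiv p d' → False)

/-- All derivable judgements for `p` agree with `p ⇓ d`. -/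
def DetDiv {σ : Signature} {A : Ty} (p : Comp σ [] A) (d : ℝ≥0∞) : Prop :=
  (∀ d', BigDiv p d' → d = d') ∧ (∀ e v, BigConv p e v → False)

theorem tsum_eq_zero_add_enn (f : ℕ → ℝ≥0∞) : (∑' i, f i) = f 0 + ∑' i, f (i + 1) := by
  have h : Summable (fun i => f (i + 1)) := ENNReal.summable
  exact tsum_eq_zero_add' h

theorem tsum_split (ds : ℕ → ℝ≥0) (n : ℕ) :
    (∑' i : ℕ, (ds (n + i) : ℝ≥0∞)) = ds n + ∑' i : ℕ, (ds (n + 1 + i) : ℝ≥0∞) := by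
  have h := tsum_eq_zero_add_enn (fun i => (ds (n + i) : ℝ≥0∞))
  simpa only [add_zero, add_assoc, add_comm 1] using h

/-- A loop whose iterations are all determined diverges only with the sum of durations. -/
theorem wh_div_det {σ : Signature} {A : Ty} {x : Comp σ [] A} {r : ℝ≥0∞} (hx : BigDiv x r) :
    ∀ (p : Comp σ [] A) (b : Val σ [A] Ty.bool) (q : Comp σ [A] A)
      (ws : ℕ → Val σ [] A) (ds : ℕ → ℝ≥0) (n : ℕ), x = .wh p b q →
      DetConv p (ds n) (ws n) →
      (∀ i, DetConv (q.inst (ws i)) (ds (i + 1)) (ws (i + 1))) →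
      (∑' i : ℕ, (ds (n + i) : ℝ≥0∞)) = r := by
  refine BigDiv.rec
    (motive_1 := fun {A} x r _ => ∀ (p : Comp σ [] A) (b : Val σ [A] Ty.bool) (q : Comp σ [A] A)
      (ws : ℕ → Val σ [] A) (ds : ℕ → ℝ≥0) (n : ℕ), x = .wh p b q →
      DetConv p (ds n) (ws n) →
      (∀ i, DetConv (q.inst (ws i)) (ds (i + 1)) (ws (i + 1))) →
      (∑' i : ℕ, (ds (n + i) : ℝ≥0∞)) = r)
    (motive_2 := fun _ _ _ _ => True)
    ?_ ?_ ?_ ?_ ?_ ?_ ?wh1 ?wh3 ?wh5 ?_ ?_ ?_ ?_ ?_ ?_ ?_ ?_ hx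
  case wh1 =>
    intro A p b q d h _ p' b' q' ws ds n e hp hq
    cases e
    exact (hp.2 _ h).elim
  case wh3 =>
    intro A p b q d w r h hb h' _ ih p' b' q' ws ds n e hp hq
    cases e
    obtain ⟨rfl, rfl⟩ := hp.1 _ _ h
    rw [tsum_split, ih _ _ _ ws ds (n + 1) rfl (hq n) hq]
  case wh5 =>
    intro A p b q ws' ds' h hb hs _ _ p' b' q' ws ds n e hp hq
    cases e
    have key : ∀ i, ds (n + i) = ds' i ∧ ws (n + i) = ws' i := by
      intro i
      induction i with
      | zero => exact hp.1 _ _ h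
      | succ i ih =>
        have := hs i
        rw [← ih.2] at this
        exact (hq (n + i)).1 _ _ this
    exact tsum_congr fun i => by rw [(key i).1]
  all_goals intros
  all_goals trivial

/-- A loop whose iterations are all determined and pass the guard does not terminate. -/
theorem wh_conv_det {σ : Signature} {A : Ty} {x : Comp σ [] A} {r : ℝ≥0} {u : Val σ [] A}
    (hx : BigConv x r u) :
    ∀ (p : Comp σ [] A) (b : Val σ [A] Ty.bool) (q : Comp σ [A] A)
      (ws : ℕ → Val σ [] A) (ds : ℕ → ℝ≥0) (n : ℕ), x = .wh p b q →
      DetConv p (ds n) (ws n) → (∀ i, (b.inst (ws i)).den () = true) →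
      (∀ i, DetConv (q.inst (ws i)) (ds (i + 1)) (ws (i + 1))) → False := by
  refine BigConv.rec
    (motive_1 := fun _ _ _ => True)
    (motive_2 := fun {A} x _ _ _ => ∀ (p : Comp σ [] A) (b : Val σ [A] Ty.bool)
      (q : Comp σ [A] A)
      (ws : ℕ → Val σ [] A) (ds : ℕ → ℝ≥0) (n : ℕ), x = .wh p b q →
      DetConv p (ds n) (ws n) → (∀ i, (b.inst (ws i)).den () = true) →
      (∀ i, DetConv (q.inst (ws i)) (ds (i + 1)) (ws (i + 1))) → False)
    ?_ ?_ ?_ ?_ ?_ ?_ ?_ ?_ ?_ ?_ ?_ ?_ ?_ ?_ ?_ ?wh2 ?wh4 hx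
  case wh2 =>
    intro A p b q d w h hb _ p' b' q' ws ds n e hp hg hq
    cases e
    obtain ⟨rfl, rfl⟩ := hp.1 _ _ h
    have := hg n
    simp_all
  case wh4 =>
    intro A p b q d r w u h hb h' _ ih p' b' q' ws ds n e hp hg hq
    cases e
    obtain ⟨rfl, rfl⟩ := hp.1 _ _ h
    exact ih _ _ _ ws ds (n + 1) rfl (hq n) hg hq
  all_goals intros
  all_goals trivial

mutual
theorem det_div {σ : Signature} {A : Ty} {p : Comp σ [] A} {d : ℝ≥0∞} :
    BigDiv p d → DetDiv p d
  | .pm h => by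
    have ih := det_div h
    refine ⟨fun d' h' => ?_, fun e u h' => ?_⟩
    · cases h' with | pm h' => exact ih.1 _ h'
    · cases h' with | pm h' => exact ih.2 _ _ h'
  | .condT hv h => by
    have ih := det_div h
    refine ⟨fun d' h' => ?_, fun e u h' => ?_⟩
    · cases h' with
      | condT _ h' => exact ih.1 _ h'
      | condF hf _ => simp [hv] at hf
    · cases h' with
      | condT _ h' => exact ih.2 _ _ h'
      | condF hf _ => simp [hv] at hf
  | .condF hv h => by
    have ih := det_div h
    refine ⟨fun d' h' => ?_, fun e u h' => ?_⟩
    · cases h' with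
      | condF _ h' => exact ih.1 _ h'
      | condT hf _ => simp [hv] at hf
    · cases h' with
      | condF _ h' => exact ih.2 _ _ h'
      | condT hf _ => simp [hv] at hf
  | .seq1 h => by
    have ih := det_div h
    refine ⟨fun d' h' => ?_, fun e u h' => ?_⟩
    · cases h' with
      | seq1 h' => exact ih.1 _ h'
      | seq2 h' _ => exact (ih.2 _ _ h').elim
    · cases h' with | seq h' _ => exact ih.2 _ _ h'
  | .seq2 h k => by
    have ih := det_conv h
    have ik := det_div k
    refine ⟨fun d' h' => ?_, fun e u h' => ?_⟩
    · cases h' with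
      | seq1 h' => exact (ih.2 _ h').elim
      | seq2 h' k' =>
        obtain ⟨rfl, rfl⟩ := ih.1 _ _ h'
        rw [ik.1 _ k']
    · cases h' with
      | seq h' k' =>
        obtain ⟨rfl, rfl⟩ := ih.1 _ _ h'
        exact ik.2 _ _ k'
  | .traj hs => by
    refine ⟨fun d' h' => ?_, fun e u h' => ?_⟩
    · cases h' with | traj _ => rfl
    · cases h' with | traj h1 h2 => exact hs ⟨_, h1, h2⟩
  | .wh1 h => by
    have ih := det_div h
    refine ⟨fun d' h' => ?_, fun e u h' => ?_⟩
    · cases h' with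
      | wh1 h' => exact ih.1 _ h'
      | wh3 h' _ _ => exact (ih.2 _ _ h').elim
      | wh5 _ _ h' _ _ => exact (ih.2 _ _ h').elim
    · cases h' with
      | wh2 h' _ => exact ih.2 _ _ h'
      | wh4 h' _ _ => exact ih.2 _ _ h'
  | .wh3 h hb k => by
    have ih := det_conv h
    have ik := det_div k
    refine ⟨fun d' h' => ?_, fun e u h' => ?_⟩
    · cases h' with
      | wh1 h' => exact (ih.2 _ h').elim
      | wh3 h' _ k' =>
        obtain ⟨rfl, rfl⟩ := ih.1 _ _ h'
        rw [ik.1 _ k']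
      | wh5 ws ds h' hg hs =>
        obtain ⟨rfl, rfl⟩ := ih.1 _ _ h'
        rw [tsum_eq_zero_add_enn (fun i => (ds i : ℝ≥0∞)), ik.1 _ (.wh5 (fun i => ws (i + 1)) (fun i => ds (i + 1)) (hs 0)
          (fun i => hg (i + 1)) (fun i => hs (i + 1)))]
    · cases h' with
      | wh2 h' hf =>
        obtain ⟨rfl, rfl⟩ := ih.1 _ _ h'
        simp [hb] at hf
      | wh4 h' _ k' =>
        obtain ⟨rfl, rfl⟩ := ih.1 _ _ h'
        exact ik.2 _ _ k'
  | .wh5 ws ds h hg hs => by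
    have ih := det_conv h
    have is := fun i => det_conv (hs i)
    refine ⟨fun d' h' => ?_, fun e u h' => ?_⟩
    · simpa using wh_div_det h' _ _ _ ws ds 0 rfl ih is
    · exact wh_conv_det h' _ _ _ ws ds 0 rfl ih hg is

theorem det_conv {σ : Signature} {A : Ty} {p : Comp σ [] A} {d : ℝ≥0} {v : Val σ [] A} :
    BigConv p d v → DetConv p d v
  | .now => by
    refine ⟨fun d' u h' => ?_, fun d' h' => ?_⟩
    · cases h' with | now => exact ⟨rfl, rfl⟩
    · cases h'
  | .pm h => by
    have ih := det_conv h
    refine ⟨fun d' u h' => ?_, fun d' h' => ?_⟩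
    · cases h' with | pm h' => exact ih.1 _ _ h'
    · cases h' with | pm h' => exact ih.2 _ h'
  | .condT hv h => by
    have ih := det_conv h
    refine ⟨fun d' u h' => ?_, fun d' h' => ?_⟩
    · cases h' with
      | condT _ h' => exact ih.1 _ _ h'
      | condF hf _ => simp [hv] at hf
    · cases h' with
      | condT _ h' => exact ih.2 _ h'
      | condF hf _ => simp [hv] at hf
  | .condF hv h => by
    have ih := det_conv h
    refine ⟨fun d' u h' => ?_, fun d' h' => ?_⟩
    · cases h' with
      | condF _ h' => exact ih.1 _ _ h'
      | condT hf _ => simp [hv] at hf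
    · cases h' with
      | condF _ h' => exact ih.2 _ h'
      | condT hf _ => simp [hv] at hf
  | .seq h k => by
    have ih := det_conv h
    have ik := det_conv k
    refine ⟨fun d' u h' => ?_, fun d' h' => ?_⟩
    · cases h' with
      | seq h' k' =>
        obtain ⟨rfl, rfl⟩ := ih.1 _ _ h'
        obtain ⟨rfl, rfl⟩ := ik.1 _ _ k'
        exact ⟨rfl, rfl⟩
    · cases h' with
      | seq1 h' => exact ih.2 _ h'
      | seq2 h' k' =>
        obtain ⟨rfl, rfl⟩ := ih.1 _ _ h'
        exact ik.2 _ k'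
  | .traj h1 h2 => by
    refine ⟨fun d' u h' => ?_, fun d' h' => ?_⟩
    · cases h' with
      | traj h1' h2' =>
        have := ENNReal.coe_injective (h1.symm.trans h1')
        subst this
        exact ⟨rfl, rfl⟩
    · cases h' with | traj hs => exact hs ⟨_, h1, h2⟩
  | .wh2 h hb => by
    have ih := det_conv h
    refine ⟨fun d' u h' => ?_, fun d' h' => ?_⟩
    · cases h' with
      | wh2 h' _ => exact ih.1 _ _ h'
      | wh4 h' ht _ =>
        obtain ⟨rfl, rfl⟩ := ih.1 _ _ h'
        simp [hb] at ht
    · cases h' with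
      | wh1 h' => exact ih.2 _ h'
      | wh3 h' ht _ =>
        obtain ⟨rfl, rfl⟩ := ih.1 _ _ h'
        simp [hb] at ht
      | wh5 ws ds h' hg _ =>
        obtain ⟨rfl, rfl⟩ := ih.1 _ _ h'
        have ht := hg 0
        simp [hb] at ht
  | .wh4 h hb k => by
    have ih := det_conv h
    have ik := det_conv k
    refine ⟨fun d' u h' => ?_, fun d' h' => ?_⟩
    · cases h' with
      | wh2 h' hf =>
        obtain ⟨rfl, rfl⟩ := ih.1 _ _ h'
        simp [hb] at hf
      | wh4 h' _ k' =>
        obtain ⟨rfl, rfl⟩ := ih.1 _ _ h'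
        obtain ⟨rfl, rfl⟩ := ik.1 _ _ k'
        exact ⟨rfl, rfl⟩
    · cases h' with
      | wh1 h' => exact ih.2 _ h'
      | wh3 h' _ k' =>
        obtain ⟨rfl, rfl⟩ := ih.1 _ _ h'
        exact ik.2 _ k'
      | wh5 ws ds h' hg hs =>
        obtain ⟨rfl, rfl⟩ := ih.1 _ _ h'
        exact ik.2 _ (.wh5 (fun i => ws (i + 1)) (fun i => ds (i + 1)) (hs 0)
          (fun i => hg (i + 1)) (fun i => hs (i + 1)))
end

/-- **Determinacy of the big-step duration semantics** (Proposition 4.1): for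
every closed HybCore computation term `p`, at most one big-step duration
judgement of the form `p ⇓ d` or `p ⇓ d, v` is derivable; in particular `p`
cannot both diverge and terminate, and in each case the duration `d` (and the
value `v`) are uniquely determined by `p`. -/
theorem bigstep_determinacy {σ : Signature} {A : Ty} (p : Comp σ [] A) :
    (∀ d d' : ℝ≥0∞, BigDiv p d → BigDiv p d' → d = d') ∧
    (∀ (d d' : ℝ≥0) (v v' : Val σ [] A),
      BigConv p d v → BigConv p d' v' → d = d' ∧ v = v') ∧
    (∀ (d : ℝ≥0∞) (e : ℝ≥0) (v : Val σ [] A),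
      BigDiv p d → BigConv p e v → False) := by
  exact ⟨fun _ _ h h' => (det_div h).1 _ h', fun _ _ _ _ h h' => (det_conv h).1 _ _ h',
    fun _ _ _ h h' => (det_div h).2 _ _ h'⟩
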